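/- Let A ⊆ ℂ∖{0} be a multiplicative subgroup and let Λ be a lattice in ℂ. Suppose δ : ℂ → ℂ is holomorphic with nowhere-vanishing derivative, and a : Λ → ℂ, t : Λ → ℂ are functions with a(λ) ∈ A and δ(z+λ) = a(λ)·δ(z) + t(λ) for all z ∈ ℂ and all λ ∈ Λ. Then either a(λ) = 1 for all λ ∈ Λ and δ is affine (δ(z) = α·z + β with α ≠ 0), or there exists a grain for Λ and A, i.e. a nonzero c ∈ ℂ with exp(c·λ) ∈ A for all λ ∈ Λ, together with k ≠ 0 and d ∈ ℂ, such that δ(z) = k·exp(c·z) + d for all z and a(λ) = exp(c·λ) for all λ ∈ Λ. (Hence every (A ⋉ ℂ)/A-structure on the elliptic curve ℂ/Λ is either a translation structure or is constructed from a grain.) -/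

import Mathlib

/-- An entire function that is periodic under a subgroup spanning `ℂ` over `ℝ` is constant. -/
theorem Differentiable.apply_eq_apply_of_periodic {Λ : AddSubgroup ℂ}
    (hspan : Submodule.span ℝ (Λ : Set ℂ) = ⊤) {g : ℂ → ℂ} (hg : Differentiable ℂ g)
    (hper : ∀ z : ℂ, ∀ w ∈ Λ, g (z + w) = g z) (z w : ℂ) : g z = g w := by
  let b := Module.Basis.ofSpan hspan.ge
  have := @Fintype.ofFinite _ (Module.Finite.finite_basis b)
  refine hg.apply_eq_apply_of_bounded ?_ z w
  refine ((ZSpan.fundamentalDomain_isBounded b).isCompact_closure.image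
    hg.continuous).isBounded.subset ?_
  rintro _ ⟨x, rfl⟩
  refine ⟨ZSpan.fract b x, subset_closure (ZSpan.fract_mem_fundamentalDomain b x), ?_⟩
  have hfloor : (ZSpan.floor b x : ℂ) ∈ Λ := by
    have hle : Submodule.span ℤ (Set.range b) ≤ Λ.toIntSubmodule :=
      Submodule.span_le.2 (Module.Basis.ofSpan_subset hspan.ge)
    exact hle (ZSpan.floor b x).2
  rw [← hper _ _ hfloor, ZSpan.fract_apply, sub_add_cancel]

/-- An entire solution of `f' = c f` is a multiple of `exp (c z)`. -/
theorem eq_mul_exp_of_deriv_eq_mul {f : ℂ → ℂ} (hf : Differentiable ℂ f) {c : ℂ}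
    (h : ∀ z, deriv f z = c * f z) (z : ℂ) : f z = f 0 * Complex.exp (c * z) := by
  have hd : ∀ x, HasDerivAt (fun z => f z * Complex.exp (-(c * z))) 0 x := fun x => by
    have h1 := (hf x).hasDerivAt
    rw [h x] at h1
    have h2 : HasDerivAt (fun z : ℂ => Complex.exp (-(c * z)))
        (Complex.exp (-(c * x)) * -(c * 1)) x := ((hasDerivAt_id x).const_mul c).neg.cexp
    exact (h1.mul h2).congr_deriv (by ring)
  have h0 := is_const_of_deriv_eq_zero (fun x => (hd x).differentiableAt)
    (fun x => (hd x).deriv) z 0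
  simp only [mul_zero, neg_zero, Complex.exp_zero, mul_one] at h0
  rw [← h0, mul_assoc, ← Complex.exp_add, neg_add_cancel, Complex.exp_zero, mul_one]

/-- every `(A ⋉ ℂ)/A`-structure on the elliptic curve `ℂ/Λ` is
a translation structure or is constructed from a grain: here `A ⊆ ℂ \ {0}` is
a multiplicative subgroup, and a grain is a nonzero `c` with
`exp (c λ) ∈ A` for all `λ ∈ Λ`. -/
theorem stmt_6
    (A : Set ℂ)
    (hA0 : (0 : ℂ) ∉ A)
    (hA1 : (1 : ℂ) ∈ A)
    (hAmul : ∀ x ∈ A, ∀ y ∈ A, x * y ∈ A)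
    (hAinv : ∀ x ∈ A, x⁻¹ ∈ A)
    (Λ : AddSubgroup ℂ)
    (hdisc : DiscreteTopology Λ)
    (hspan : Submodule.span ℝ (Λ : Set ℂ) = ⊤)
    (δ : ℂ → ℂ)
    (hδ : Differentiable ℂ δ)
    (hδ' : ∀ z : ℂ, deriv δ z ≠ 0)
    (a t : ℂ → ℂ)
    (ha : ∀ lam ∈ Λ, a lam ∈ A)
    (hper : ∀ z : ℂ, ∀ lam ∈ Λ, δ (z + lam) = a lam * δ z + t lam) :
    ((∀ lam ∈ Λ, a lam = 1) ∧
      ∃ α β : ℂ, α ≠ 0 ∧ ∀ z : ℂ, δ z = α * z + β) ∨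
    (∃ c : ℂ, c ≠ 0 ∧ (∀ lam ∈ Λ, Complex.exp (c * lam) ∈ A) ∧
      ∃ k d : ℂ, k ≠ 0 ∧ (∀ z : ℂ, δ z = k * Complex.exp (c * z) + d) ∧
        ∀ lam ∈ Λ, a lam = Complex.exp (c * lam)) := by
  have hf : Differentiable ℂ (deriv δ) := hδ.deriv
  have deriv_per : ∀ {F : ℂ → ℂ}, ∀ m s w : ℂ, (∀ z, F (z + w) = m * F z + s) →
      ∀ z, deriv F (z + w) = m * deriv F z := fun {F} m s w h z => by
    rw [← deriv_comp_add_const, funext h, deriv_add_const, deriv_const_mul_field]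
  have hfper : ∀ z, ∀ lam ∈ Λ, deriv δ (z + lam) = a lam * deriv δ z := fun z lam hl =>
    deriv_per _ _ _ (fun z => hper z lam hl) z
  have ha0 : ∀ lam ∈ Λ, a lam ≠ 0 := fun lam hl h => hA0 (h ▸ ha lam hl)
  obtain ⟨c, hc⟩ : ∃ c : ℂ, ∀ z, deriv (deriv δ) z = c * deriv δ z := by
    refine ⟨deriv (deriv δ) 0 / deriv δ 0, fun z => ?_⟩
    have hconst := (hf.deriv.fun_div hf hδ').apply_eq_apply_of_periodic hspan
      (fun z lam hl => by
        rw [hfper z lam hl, deriv_per (a lam) 0 lam (fun z => by simp [hfper z lam hl]) z,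
          mul_div_mul_left _ _ (ha0 lam hl)]) z 0
    rw [← hconst, div_mul_cancel₀ _ (hδ' z)]
  have hexp := eq_mul_exp_of_deriv_eq_mul hf hc
  have hac : ∀ lam ∈ Λ, a lam = Complex.exp (c * lam) := fun lam hl => by
    have h := hfper 0 lam hl
    rw [zero_add, hexp lam, mul_comm] at h
    exact (mul_right_cancel₀ (hδ' 0) h).symm
  have primitive : ∀ G : ℂ → ℂ, (∀ z, HasDerivAt G (deriv δ z) z) →
      ∀ z, δ z = G z + (δ 0 - G 0) := fun G hG z => by
    have hd : ∀ x, HasDerivAt (fun z => δ z - G z) 0 x := fun x =>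
      ((hδ x).hasDerivAt.sub (hG x)).congr_deriv (sub_self _)
    have h0 := is_const_of_deriv_eq_zero (fun x => (hd x).differentiableAt)
      (fun x => (hd x).deriv) z 0
    rw [← h0]
    ring
  rcases eq_or_ne c 0 with rfl | hc0
  · refine Or.inl ⟨fun lam hl => by simpa using hac lam hl, deriv δ 0, _, hδ' 0,
      primitive (fun z => deriv δ 0 * z) fun z => ?_⟩
    rw [hexp z]
    simpa using (hasDerivAt_id z).const_mul (deriv δ 0)
  · refine Or.inr ⟨c, hc0, fun lam hl => hac lam hl ▸ ha lam hl, deriv δ 0 / c, _,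
      div_ne_zero (hδ' 0) hc0,
      primitive (fun z => deriv δ 0 / c * Complex.exp (c * z)) fun z => ?_, hac⟩
    rw [hexp z]
    have h : HasDerivAt (fun z : ℂ => Complex.exp (c * z)) (Complex.exp (c * z) * (c * 1)) z :=
      ((hasDerivAt_id z).const_mul c).cexp
    exact (h.const_mul (deriv δ 0 / c)).congr_deriv (by field_simp)
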